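/- arXiv:2012.10369 — 2 statements merged into one kernel-verified Lean document; each statement's English description precedes it below -/
import Mathlib

section
/- Let H be a separable real Hilbert space, X a measurable space, ψ : X → H a measurable feature map with ‖ψ(x)‖ ≤ R for all x ∈ X, and μ a probability measure on X. Fix m ≥ 1 and let Π : X^m → B(H) be a measurable map such that Π(s) is an orthogonal projection operator for every s ∈ X^m (in particular, the orthogonal projection onto the subspace V̂_k(s) spanned by k eigenvectors of the sample covariance C(s) corresponding to its k largest eigenvalues). Then for every δ ∈ (0,1], with probability at least 1 − δ over an iid 2m-sample S = S₁ ∪ S₂ with S₁ = (x₁,…,x_m), S₂ = (x_{m+1},…,x_{2m}) drawn from μ^{2m}: E_{x∼μ}[‖Π(S₁)ψ(x)‖²] ≥ (1/m) Σ_{i=1}^m ‖Π(S₁)ψ(x_{m+i})‖² − R²·√((2/m)·log(1/δ)). -/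
open MeasureTheory

/-- One-sided Hoeffding bound for the empirical mean of a function with values in `[0, B]`. -/
theorem one_sub_le_pi_mean_sub_le_integral {X : Type*} [MeasurableSpace X]
    (μ : Measure X) [IsProbabilityMeasure μ] {m : ℕ} (hm : 1 ≤ m) {f : X → ℝ}
    (hf : Measurable f) {B : ℝ} (hfB : ∀ x, f x ∈ Set.Icc 0 B)
    {δ : ℝ} (hδ : δ ∈ Set.Ioc (0 : ℝ) 1) :
    ENNReal.ofReal (1 - δ) ≤ (Measure.pi fun _ : Fin m => μ)
      {y | (1 / (m : ℝ)) * ∑ i, f (y i) - B * Real.sqrt ((2 / (m : ℝ)) * Real.log (1 / δ))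
        ≤ ∫ x, f x ∂μ} := by
  obtain ⟨x₀⟩ : Nonempty X := nonempty_of_isProbabilityMeasure μ
  have hB : 0 ≤ B := (hfB x₀).1.trans (hfB x₀).2
  have hm' : (0 : ℝ) < m := by exact_mod_cast hm
  obtain ⟨hδ₀, hδ₁⟩ := hδ
  have hL : 0 ≤ Real.log (1 / δ) := Real.log_nonneg (by rw [le_div_iff₀ hδ₀]; linarith)
  rcases hB.eq_or_lt with rfl | hBpos
  · have hf0 : ∀ x, f x = 0 := fun x => le_antisymm (hfB x).2 (hfB x).1
    simp [hf0, hδ₀.le]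
  set ν := Measure.pi fun _ : Fin m => μ
  set L := Real.log (1 / δ)
  set r := Real.sqrt ((2 / (m : ℝ)) * L)
  have hr : r ^ 2 = 2 / m * L := Real.sq_sqrt (by positivity)
  set A := {y : Fin m → X | (1 / (m : ℝ)) * ∑ i, f (y i) - B * r ≤ ∫ x, f x ∂μ} with hA
  have hAmeas : MeasurableSet A := measurableSet_le (by fun_prop) measurable_const
  have hindep : ProbabilityTheory.iIndepFun (fun (i : Fin m) (y : Fin m → X) =>
      f (y i) - ∫ x, f x ∂μ) ν :=
    ProbabilityTheory.iIndepFun_pi (X := fun _ x => f x - ∫ x, f x ∂μ)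
      fun _ => (hf.sub_const _).aemeasurable
  have hsub : ∀ i ∈ (Finset.univ : Finset (Fin m)), ProbabilityTheory.HasSubgaussianMGF
      (fun y : Fin m → X => f (y i) - ∫ x, f x ∂μ) ((‖B - 0‖₊ / 2) ^ 2) ν := by
    intro i _
    have hi := measurePreserving_eval (fun _ : Fin m => μ) i
    have hint : ∫ y, f (y i) ∂ν = ∫ x, f x ∂μ := by
      rw [← hi.map_eq, integral_map hi.measurable.aemeasurable hf.aestronglyMeasurable]
    have h := ProbabilityTheory.hasSubgaussianMGF_of_mem_Icc (μ := ν)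
      (X := fun y : Fin m → X => f (y i)) (a := 0) (b := B)
      (hf.comp (measurable_pi_apply i)).aemeasurable (ae_of_all _ fun y => hfB (y i))
    rwa [hint] at h
  have hhoef := ProbabilityTheory.HasSubgaussianMGF.measure_sum_ge_le_of_iIndepFun hindep hsub
    (ε := m * (B * r)) (by positivity)
  have hexp : Real.exp (-(m * (B * r)) ^ 2 /
      (2 * ((∑ _i : Fin m, (‖B - 0‖₊ / 2) ^ 2 : NNReal) : ℝ))) ≤ δ := by
    have : -(m * (B * r)) ^ 2 / (2 * ((∑ _i : Fin m, (‖B - 0‖₊ / 2) ^ 2 : NNReal) : ℝ))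
        = -(4 * L) := by
      simp only [sub_zero, Finset.sum_const, Finset.card_univ, Fintype.card_fin, nsmul_eq_mul,
        NNReal.coe_mul, NNReal.coe_natCast, NNReal.coe_pow, NNReal.coe_div, coe_nnnorm,
        Real.norm_eq_abs, NNReal.coe_ofNat, div_pow, sq_abs, mul_pow, hr]
      field_simp
      ring
    rw [this, ← Real.le_log_iff_exp_le hδ₀]
    have : L = -Real.log δ := by simp [L]
    linarith
  have hcompl : Aᶜ ⊆ {y | m * (B * r) ≤ ∑ i, (f (y i) - ∫ x, f x ∂μ)} := by
    intro y hy
    simp only [hA, Set.mem_compl_iff, Set.mem_ofPred_eq, not_le] at hy ⊢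
    rw [Finset.sum_sub_distrib, Finset.sum_const, Finset.card_univ, Fintype.card_fin,
      nsmul_eq_mul]
    have h := mul_lt_mul_of_pos_left hy hm'
    have h' : (m : ℝ) * (1 / m * ∑ i, f (y i) - B * r) = ∑ i, f (y i) - m * (B * r) := by
      field_simp
    linarith
  have hreal : 1 - δ ≤ ν.real A := by
    have h := (measureReal_mono (μ := ν) hcompl).trans (hhoef.trans (by exact_mod_cast hexp))
    rw [probReal_compl_eq_one_sub hAmeas] at h
    linarith
  exact ENNReal.ofReal_le_of_le_toReal hreal

/-- A slice-wise lower bound on a measurable set bounds its measure in a product of probability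
measures. -/
theorem le_prod_apply_of_forall_le {α β : Type*} [MeasurableSpace α] [MeasurableSpace β]
    {μ : Measure α} {ν : Measure β} [IsProbabilityMeasure μ] [SFinite ν]
    {s : Set (α × β)} (hs : MeasurableSet s) {c : ENNReal}
    (h : ∀ a, c ≤ ν (Prod.mk a ⁻¹' s)) : c ≤ μ.prod ν s := by
  rw [Measure.prod_apply hs]
  calc c = ∫⁻ _, c ∂μ := by simp
    _ ≤ _ := lintegral_mono h

/-- Applying a measurable family of operators on a separable space is jointly measurable. -/
theorem measurable_uncurry_clm_apply {α H : Type*} [MeasurableSpace α]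
    [NormedAddCommGroup H] [NormedSpace ℝ H] [SecondCountableTopology H]
    [MeasurableSpace H] [BorelSpace H] [MeasurableSpace (H →L[ℝ] H)] [BorelSpace (H →L[ℝ] H)]
    {P : α → H →L[ℝ] H} (hP : Measurable P) :
    Measurable fun p : α × H => P p.1 p.2 := by
  have h : Measurable (Function.uncurry fun (v : H) (a : α) => P a v) :=
    measurable_uncurry_of_continuous_of_measurable (fun a => (P a).continuous)
      fun v => (ContinuousLinearMap.apply ℝ H v).continuous.measurable.comp hP
  exact h.comp measurable_swap

/-- An orthogonal projection operator does not increase norms. -/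
theorem norm_apply_le_of_isSelfAdjoint_of_comp_self {H : Type*} [NormedAddCommGroup H]
    [InnerProductSpace ℝ H] [CompleteSpace H] {T : H →L[ℝ] H}
    (hT : IsSelfAdjoint T) (hTT : T.comp T = T) (v : H) : ‖T v‖ ≤ ‖v‖ := by
  have h : ‖T v‖ ^ 2 ≤ ‖T v‖ * ‖v‖ := by
    rw [← real_inner_self_eq_norm_sq]
    have h1 : inner ℝ (T v) (T v) = inner ℝ (T v) v := by
      have h2 := ContinuousLinearMap.adjoint_inner_left T v (T v)
      rw [hT.adjoint_eq, ← ContinuousLinearMap.comp_apply, hTT] at h2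
      exact h2.symm
    rw [h1]
    exact real_inner_le_norm _ _
  by_contra! hlt
  nlinarith [norm_nonneg v]

/-- **PAC lower bound on the expected squared projection (Theorem 3 of the paper).**
If `ψ : X → H` is a bounded measurable feature map into a separable real Hilbert space,
`P` assigns to each `m`-sample `s` an orthogonal projection operator `P s` on `H`
(e.g. the projection onto the span of the top `k` eigenvectors of the sample covariance),
then with probability at least `1 - δ` over an iid `2m`-sample `S = (S₁, S₂)` from `μ`,
the expected squared projection of a fresh point is lower bounded by the empirical average
over the second half of the sample minus `R² √((2/m) log(1/δ))`. -/
theorem stmt_0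
    {H : Type*} [NormedAddCommGroup H] [InnerProductSpace ℝ H] [CompleteSpace H]
    [SecondCountableTopology H] [MeasurableSpace H] [BorelSpace H]
    {X : Type*} [MeasurableSpace X]
    [MeasurableSpace (H →L[ℝ] H)] [BorelSpace (H →L[ℝ] H)]
    (ψ : X → H) (hψ : Measurable ψ)
    (R : ℝ) (hR : ∀ x, ‖ψ x‖ ≤ R)
    (μ : Measure X) [IsProbabilityMeasure μ]
    (m : ℕ) (hm : 1 ≤ m)
    (P : (Fin m → X) → (H →L[ℝ] H))
    (hPmeas : Measurable P)
    (hPproj : ∀ s, IsSelfAdjoint (P s) ∧ (P s).comp (P s) = P s)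
    (δ : ℝ) (hδ : δ ∈ Set.Ioc (0:ℝ) 1) :
    ENNReal.ofReal (1 - δ) ≤
      ((Measure.pi fun _ : Fin m => μ).prod (Measure.pi fun _ : Fin m => μ))
        {S : (Fin m → X) × (Fin m → X) |
          (1 / (m:ℝ)) * ∑ i : Fin m, ‖P S.1 (ψ (S.2 i))‖ ^ 2
            - R ^ 2 * Real.sqrt ((2 / (m:ℝ)) * Real.log (1 / δ))
          ≤ ∫ x, ‖P S.1 (ψ x)‖ ^ 2 ∂μ} := by
  have hjoint : Measurable fun p : (Fin m → X) × X => ‖P p.1 (ψ p.2)‖ ^ 2 :=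
    ((measurable_uncurry_clm_apply hPmeas).comp
      (measurable_fst.prodMk (hψ.comp measurable_snd))).norm.pow_const 2
  have hmem : ∀ s x, ‖P s (ψ x)‖ ^ 2 ∈ Set.Icc 0 (R ^ 2) := fun s x =>
    ⟨by positivity, pow_le_pow_left₀ (norm_nonneg _)
      ((norm_apply_le_of_isSelfAdjoint_of_comp_self (hPproj s).1 (hPproj s).2 _).trans (hR x)) 2⟩
  refine le_prod_apply_of_forall_le (measurableSet_le ?_ ?_) fun s =>
    one_sub_le_pi_mean_sub_le_integral μ hm (hjoint.comp measurable_prodMk_left) (hmem s) hδ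
  · refine Measurable.sub_const (Measurable.const_mul
      (Finset.measurable_sum _ fun i _ => ?_) _) _
    exact hjoint.comp (measurable_fst.prodMk ((measurable_pi_apply i).comp measurable_snd))
  · exact (hjoint.stronglyMeasurable.integral_prod_right' (ν := μ)).measurable.comp measurable_fst
end

section
/- For every d ≥ 1 there exist Lebesgue-measurable functions v₁,…,v_d from the space of real symmetric d×d matrices to ℝ^d such that for every symmetric matrix M: (i) M·v_i(M) = λ_i(M)·v_i(M) for each i ∈ {1,…,d}, where λ₁(M) ≥ … ≥ λ_d(M) are the eigenvalues of M in decreasing order, and (ii) the family (v₁(M),…,v_d(M)) is an orthonormal basis of ℝ^d. -/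
/-- **Lexicographic selection.** Let `G ⊆ X × K` be closed with `K` compact, and let
`g₀, …, gₙ₋₁ : K → ℝ` be continuous. There are measurable functions `fᵢ : X → ℝ` such that, over
every `x` whose section `G_x` is nonempty, `(fᵢ x)ᵢ` are the values of the `gᵢ` at a point
of `G_x`. -/
theorem exists_measurable_selection_of_isClosed {K : Type*} [TopologicalSpace K] [CompactSpace K]
    {n : ℕ} (g : Fin n → K → ℝ) (hg : ∀ i, Continuous (g i))
    {X : Type*} [TopologicalSpace X] [SecondCountableTopology X] [MeasurableSpace X]
    [OpensMeasurableSpace X] {G : Set (X × K)} (hG : IsClosed G) :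
    ∃ f : Fin n → X → ℝ, (∀ i, Measurable (f i)) ∧
      ∀ x, (∃ k, (x, k) ∈ G) → ∃ k, (x, k) ∈ G ∧ ∀ i, g i k = f i x := by
  induction n generalizing X with
  | zero => exact ⟨fun i => i.elim0, fun i => i.elim0, fun x ⟨k, hk⟩ => ⟨k, hk, fun i => i.elim0⟩⟩
  | succ n ih =>
    have hmin : ∀ x, ∃ t : ℝ, ((∃ k, (x, k) ∈ G) →
        (∃ k, (x, k) ∈ G ∧ g 0 k = t) ∧ ∀ k, (x, k) ∈ G → t ≤ g 0 k) ∧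
        ((¬ ∃ k, (x, k) ∈ G) → t = 0) := by
      intro x
      by_cases hx : ∃ k, (x, k) ∈ G
      · have hc : IsCompact {k | (x, k) ∈ G} :=
          (hG.preimage (by fun_prop : Continuous fun k : K => (x, k))).isCompact
        obtain ⟨k, hk, hle⟩ := hc.exists_isMinOn hx (hg 0).continuousOn
        exact ⟨g 0 k, fun _ => ⟨⟨k, hk, rfl⟩, fun k' hk' => hle hk'⟩, fun h => absurd hx h⟩
      · exact ⟨0, fun h => absurd h hx, fun _ => rfl⟩
    choose t ht ht0 using hmin
    have hproj : ∀ S : Set (X × K), IsClosed S → MeasurableSet {x | ∃ k, (x, k) ∈ S} := by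
      intro S hS
      have : {x | ∃ k, (x, k) ∈ S} = Prod.fst '' S := by ext x; simp
      rw [this]
      exact (isClosedMap_fst_of_compactSpace S hS).measurableSet
    have htm : Measurable t := by
      refine measurable_of_Iic fun c => ?_
      have hle : IsClosed (G ∩ {q : X × K | g 0 q.2 ≤ c}) :=
        hG.inter (isClosed_le ((hg 0).comp continuous_snd) continuous_const)
      have : t ⁻¹' Set.Iic c = {x | ∃ k, (x, k) ∈ G ∩ {q : X × K | g 0 q.2 ≤ c}} ∪
          ({x | ∃ k, (x, k) ∈ G}ᶜ ∩ {_x | 0 ≤ c}) := by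
        ext x
        by_cases hx : ∃ k, (x, k) ∈ G
        · obtain ⟨⟨k, hk, hkt⟩, hmin⟩ := ht x hx
          simp only [Set.mem_preimage, Set.mem_Iic, Set.mem_union, Set.mem_ofPred_eq,
            Set.mem_inter_iff, Set.mem_compl_iff, hx, not_true_eq_false, false_and, or_false]
          exact ⟨fun h => ⟨k, hk, hkt.le.trans h⟩, fun ⟨k', hk', h⟩ => (hmin k' hk').trans h⟩
        · have hx' : ¬ ∃ k, (x, k) ∈ G ∧ g 0 k ≤ c := fun ⟨k, hk, _⟩ => hx ⟨k, hk⟩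
          simp [hx, hx', ht0 x hx]
      rw [this]
      exact (hproj _ hle).union ((hproj _ hG).compl.inter (MeasurableSet.const _))
    have hG' : IsClosed {q : (X × ℝ) × K | (q.1.1, q.2) ∈ G ∧ g 0 q.2 ≤ q.1.2} :=
      (hG.preimage (by fun_prop : Continuous fun q : (X × ℝ) × K => (q.1.1, q.2))).inter
        (isClosed_le ((hg 0).comp continuous_snd) (by fun_prop))
    obtain ⟨f, hf, hsel⟩ := ih (fun i => g i.succ) (fun i => hg i.succ) hG'
    refine ⟨Fin.cons t fun i x => f i (x, t x), fun i => ?_, fun x hx => ?_⟩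
    · cases i using Fin.cases with
      | zero => exact htm
      | succ i => exact (hf i).comp (measurable_id.prodMk htm)
    · obtain ⟨⟨k, hk, hkt⟩, hmin⟩ := ht x hx
      obtain ⟨k', ⟨hk', hle⟩, heq⟩ := hsel (x, t x) ⟨k, hk, hkt.le⟩
      exact ⟨k', hk', Fin.cases (le_antisymm hle (hmin k' hk')) heq⟩

/-- The linear operator of the symmetric matrix with upper triangular entries `p i j`, `i ≤ j`. -/
noncomputable def symmOp {d : ℕ} (p : Fin d → Fin d → ℝ) :
    EuclideanSpace ℝ (Fin d) →ₗ[ℝ] EuclideanSpace ℝ (Fin d) :=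
  Matrix.toEuclideanLin (Matrix.of fun i j : Fin d => p (min i j) (max i j))

theorem symmOp_isSymmetric {d : ℕ} (p : Fin d → Fin d → ℝ) : (symmOp p).IsSymmetric := by
  refine Matrix.isSymmetric_toEuclideanLin_iff.mpr ?_
  ext i j
  simp [min_comm, max_comm]

theorem Continuous.symmOp_apply {d : ℕ} {Y : Type*} [TopologicalSpace Y]
    {p : Y → Fin d → Fin d → ℝ} {v : Y → EuclideanSpace ℝ (Fin d)}
    (hp : Continuous p) (hv : Continuous v) : Continuous fun y => symmOp (p y) (v y) := by
  refine (PiLp.continuous_toLp 2 _).comp (continuous_pi fun i => ?_)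
  change Continuous fun y => ∑ j, p y (min i j) (max i j) * v y j
  fun_prop

/-- `v` is an orthonormal family of eigenvectors of `symmOp p`, ordered by decreasing eigenvalue
(the eigenvalue of a unit eigenvector being its Rayleigh quotient). -/
def IsOrderedEigenframe {d : ℕ} (p : Fin d → Fin d → ℝ) (v : Fin d → EuclideanSpace ℝ (Fin d)) :
    Prop :=
  Orthonormal ℝ v ∧ (∀ i, symmOp p (v i) = inner ℝ (v i) (symmOp p (v i)) • v i) ∧
    Antitone fun i => inner ℝ (v i) (symmOp p (v i))

theorem isClosed_isOrderedEigenframe {d : ℕ} :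
    IsClosed {q : (Fin d → Fin d → ℝ) × (Fin d → EuclideanSpace ℝ (Fin d)) |
      IsOrderedEigenframe q.1 q.2} := by
  have hvec : ∀ i, Continuous fun q : (Fin d → Fin d → ℝ) × (Fin d → EuclideanSpace ℝ (Fin d)) =>
      q.2 i := fun i => by fun_prop
  have hop : ∀ i, Continuous fun q : (Fin d → Fin d → ℝ) × (Fin d → EuclideanSpace ℝ (Fin d)) =>
      symmOp q.1 (q.2 i) := fun i => continuous_fst.symmOp_apply (hvec i)
  have hray := fun i => (hvec i).inner (𝕜 := ℝ) (hop i)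
  simp only [IsOrderedEigenframe, orthonormal_iff_ite, Antitone, Set.ofPred_and, Set.ofPred_forall]
  refine .inter ?_ (.inter ?_ ?_)
  · exact isClosed_iInter fun i => isClosed_iInter fun j =>
      isClosed_eq ((hvec i).inner (hvec j)) continuous_const
  · exact isClosed_iInter fun i => isClosed_eq (hop i) ((hray i).smul (hvec i))
  · exact isClosed_iInter fun i => isClosed_iInter fun j => isClosed_iInter fun _ =>
      isClosed_le (hray j) (hray i)

theorem exists_isOrderedEigenframe {d : ℕ} (p : Fin d → Fin d → ℝ) :
    ∃ v, IsOrderedEigenframe p v := by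
  have hn : Module.finrank ℝ (EuclideanSpace ℝ (Fin d)) = d := by simp
  have hS := symmOp_isSymmetric p
  have hval : ∀ i, inner ℝ (hS.eigenvectorBasis hn i) (symmOp p (hS.eigenvectorBasis hn i)) =
      hS.eigenvalues hn i := by
    intro i
    rw [hS.apply_eigenvectorBasis hn i, inner_smul_right, real_inner_self_eq_norm_sq,
      (hS.eigenvectorBasis hn).orthonormal.1 i]
    simp
  refine ⟨hS.eigenvectorBasis hn, (hS.eigenvectorBasis hn).orthonormal, fun i => ?_, ?_⟩
  · rw [hval]
    exact hS.apply_eigenvectorBasis hn i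
  · simp only [hval]
    exact hS.eigenvalues_antitone hn

/-- There is a Borel measurable choice of an ordered orthonormal eigenframe. -/
theorem exists_measurable_isOrderedEigenframe (d : ℕ) :
    ∃ v : Fin d → (Fin d → Fin d → ℝ) → EuclideanSpace ℝ (Fin d),
      (∀ i, Measurable (v i)) ∧ ∀ p, IsOrderedEigenframe p fun i => v i p := by
  let frame : (Fin d → Fin d → Set.Icc (-1 : ℝ) 1) → Fin d → EuclideanSpace ℝ (Fin d) :=
    fun k i => WithLp.toLp 2 fun j => (k i j : ℝ)
  have hframe : Continuous frame :=
    continuous_pi fun i => (PiLp.continuous_toLp 2 _).comp (by fun_prop)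
  have hG := isClosed_isOrderedEigenframe.preimage
    ((continuous_id (X := Fin d → Fin d → ℝ)).prodMap hframe)
  obtain ⟨f, hf, hsel⟩ := exists_measurable_selection_of_isClosed
    (fun (m : Fin (d * d)) (k : Fin d → Fin d → Set.Icc (-1 : ℝ) 1) =>
      (k (finProdFinEquiv.symm m).1 (finProdFinEquiv.symm m).2 : ℝ))
    (fun m => by fun_prop) hG
  refine ⟨fun i p => WithLp.toLp 2 fun j => f (finProdFinEquiv (i, j)) p, fun i => ?_, fun p => ?_⟩
  · exact (PiLp.continuous_toLp 2 _).measurable.comp (measurable_pi_lambda _ fun j => hf _)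
  · obtain ⟨v, hv⟩ := exists_isOrderedEigenframe p
    have hv1 : ∀ i j, v i j ∈ Set.Icc (-1 : ℝ) 1 := fun i j => by
      rw [Set.mem_Icc, ← abs_le, ← Real.norm_eq_abs]
      exact (PiLp.norm_apply_le (v i) j).trans (hv.1.1 i).le
    obtain ⟨k, hk, hkf⟩ := hsel p ⟨fun i j => ⟨v i j, hv1 i j⟩, hv⟩
    have : (fun i => WithLp.toLp 2 fun j => f (finProdFinEquiv (i, j)) p) = frame k := by
      ext i j
      simp [frame, ← hkf]
    rw [this]
    exact hk


open MeasureTheory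

/-- **Measurable selection of an orthonormal eigenbasis for symmetric matrices
(Wilcox 1972, Theorem 2, as used in the paper).**
Real symmetric `d×d` matrices are parametrised by their (upper-triangular) entries
`p : Fin d → Fin d → ℝ` via `M(p) i j = p (min i j) (max i j)` (so `M(p)` only depends on the
entries `p i j` with `i ≤ j`, i.e. on `ℝ^{d(d+1)/2}`).  There exist Lebesgue-measurable
(i.e. `NullMeasurable` with respect to the Lebesgue measure `volume`) functions
`v₁, …, v_d` of the matrix and eigenvalue functions `lam₁ ≥ ⋯ ≥ lam_d` (the eigenvalues in
decreasing order, counted with multiplicity) such that for every symmetric matrix `M(p)`: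
`M(p) · vᵢ(p) = lamᵢ(p) · vᵢ(p)` for each `i`, and `(v₁(p), …, v_d(p))` is an orthonormal
basis of `ℝ^d`. -/
theorem stmt_4 (d : ℕ) (hd : 1 ≤ d) :
    ∃ (v : Fin d → (Fin d → Fin d → ℝ) → EuclideanSpace ℝ (Fin d))
      (lam : Fin d → (Fin d → Fin d → ℝ) → ℝ),
      (∀ i, NullMeasurable (v i) (volume : Measure (Fin d → Fin d → ℝ))) ∧
      (∀ p : Fin d → Fin d → ℝ,
        Antitone (fun i => lam i p) ∧
        Orthonormal ℝ (fun i => v i p) ∧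
        (∀ i, Matrix.toEuclideanLin
            (Matrix.of fun i j : Fin d => p (min i j) (max i j)) (v i p)
          = lam i p • v i p) ∧
        Submodule.span ℝ (Set.range fun i => v i p) = ⊤) := by
  obtain ⟨v, hvm, hv⟩ := exists_measurable_isOrderedEigenframe d
  refine ⟨v, fun i p => inner ℝ (v i p) (symmOp p (v i p)), fun i => (hvm i).nullMeasurable,
    fun p => ⟨(hv p).2.2, (hv p).1, (hv p).2.1, ?_⟩⟩
  exact (hv p).1.linearIndependent.span_eq_top_of_card_eq_finrank' (by simp)
end
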